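/- Let n ≥ 2 and let f : ℝⁿ → ℝ be a C² function whose graph has bounded mean curvature, i.e. sup_{x∈ℝⁿ} |H(x)| < ∞. Then inf_{x∈ℝⁿ} |R(x)| = 0; equivalently, for every ε > 0 there exists x ∈ ℝⁿ with |R(x)| < ε. -/

import Mathlib

open Metric Finset

/-- Coordinates of the gradient of `f` at `x`. -/
noncomputable def grad (n : ℕ) (f : EuclideanSpace ℝ (Fin n) → ℝ)
    (x : EuclideanSpace ℝ (Fin n)) : Fin n → ℝ :=
  fun i => fderiv ℝ f x (EuclideanSpace.single i 1)

/-- The Hessian matrix `D²f(x)`. -/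
noncomputable def hess (n : ℕ) (f : EuclideanSpace ℝ (Fin n) → ℝ)
    (x : EuclideanSpace ℝ (Fin n)) : Matrix (Fin n) (Fin n) ℝ :=
  Matrix.of fun i j =>
    fderiv ℝ (fun y => fderiv ℝ f y (EuclideanSpace.single j 1)) x (EuclideanSpace.single i 1)

/-- `|∇f(x)|²`. -/
noncomputable def gradSq (n : ℕ) (f : EuclideanSpace ℝ (Fin n) → ℝ)
    (x : EuclideanSpace ℝ (Fin n)) : ℝ :=
  ∑ i, grad n f x i ^ 2

/-- The shape operator of the graph of `f`, with respect to the upward unit normal: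
`W(x) = (1+|∇f|²)^{-1/2} (Iₙ - ∇f ∇fᵀ/(1+|∇f|²)) D²f(x)`. -/
noncomputable def shapeOp (n : ℕ) (f : EuclideanSpace ℝ (Fin n) → ℝ)
    (x : EuclideanSpace ℝ (Fin n)) : Matrix (Fin n) (Fin n) ℝ :=
  (Real.sqrt (1 + gradSq n f x))⁻¹ •
    (((1 : Matrix (Fin n) (Fin n) ℝ) -
      Matrix.of fun i j => grad n f x i * grad n f x j / (1 + gradSq n f x)) * hess n f x)

/-- The mean curvature `H(x) = tr W(x) / n`. -/
noncomputable def meanCurv (n : ℕ) (f : EuclideanSpace ℝ (Fin n) → ℝ)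
    (x : EuclideanSpace ℝ (Fin n)) : ℝ :=
  (shapeOp n f x).trace / n

/-- The scalar curvature `R(x) = ((tr W)² - tr(W²)) / (n(n-1))`. -/
noncomputable def scalarCurv (n : ℕ) (f : EuclideanSpace ℝ (Fin n) → ℝ)
    (x : EuclideanSpace ℝ (Fin n)) : ℝ :=
  ((shapeOp n f x).trace ^ 2 - (shapeOp n f x * shapeOp n f x).trace) /
    ((n : ℝ) * ((n : ℝ) - 1))

/-- The length `|A|(x) = √(tr(W(x)²))` of the second fundamental form. -/
noncomputable def normA (n : ℕ) (f : EuclideanSpace ℝ (Fin n) → ℝ)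
    (x : EuclideanSpace ℝ (Fin n)) : ℝ :=
  Real.sqrt ((shapeOp n f x * shapeOp n f x).trace)

/-- A continuous real function on a preconnected space taking a value at most `a` and a value at
least `-a` takes a value in `[-a, a]`. -/
theorem exists_abs_le_of_exists_le_of_exists_ge {X : Type*} [TopologicalSpace X]
    [PreconnectedSpace X] {T : X → ℝ} (hT : Continuous T) {a : ℝ} (ha : 0 ≤ a)
    (h₁ : ∃ x, T x ≤ a) (h₂ : ∃ x, -a ≤ T x) : ∃ x, |T x| ≤ a := by
  obtain ⟨x, hx⟩ := h₁
  obtain ⟨y, hy⟩ := h₂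
  by_cases hx' : -a ≤ T x
  · exact ⟨x, abs_le.2 ⟨hx', hx⟩⟩
  by_cases hy' : T y ≤ a
  · exact ⟨y, abs_le.2 ⟨hy, hy'⟩⟩
  obtain ⟨z, hz⟩ := mem_range_of_exists_le_of_exists_ge hT
    (c := 0) ⟨x, by linarith⟩ ⟨y, by linarith⟩
  exact ⟨z, by simpa [hz] using ha⟩

/-- The second-order necessary condition for a local maximum on the line. -/
theorem IsLocalMax.deriv_deriv_nonpos {u : ℝ → ℝ} {a : ℝ} (h : IsLocalMax u a)
    (hu : ContinuousAt u a) : deriv (deriv u) a ≤ 0 := by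
  by_contra! hpos
  have hmin := isLocalMin_of_deriv_deriv_pos hpos h.deriv_eq_zero hu
  have hconst : u =ᶠ[nhds a] fun _ => u a := by
    filter_upwards [h, hmin] with t h₁ h₂ using le_antisymm h₁ h₂
  have := hconst.deriv.deriv_eq
  simp at this
  linarith

namespace Matrix

variable {ι : Type*}

theorem PosSemidef.apply_mul_apply_le {E : Matrix ι ι ℝ} (hE : E.PosSemidef) (i j : ι) :
    E i j * E j i ≤ E i i * E j j := by
  have hdet := (hE.submatrix ![i, j]).det_nonneg
  rw [det_fin_two] at hdet
  simpa using hdet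

variable [Fintype ι]

theorem PosSemidef.trace_mul_self_le {E : Matrix ι ι ℝ} (hE : E.PosSemidef) :
    (E * E).trace ≤ E.trace ^ 2 := by
  simp only [trace, diag_apply, mul_apply, sq, Finset.sum_mul_sum]
  exact Finset.sum_le_sum fun i _ => Finset.sum_le_sum fun j _ => hE.apply_mul_apply_le i j

theorem IsSymm.trace_mul_self_nonneg {B : Matrix ι ι ℝ} (hB : B.IsSymm) :
    0 ≤ (B * B).trace := by
  simp only [trace, diag_apply, mul_apply]
  exact Finset.sum_nonneg fun i _ => Finset.sum_nonneg fun j _ => by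
    rw [hB.apply i j]
    exact mul_self_nonneg _

/-- If `B ≤ δ`, then twice the second elementary symmetric function of the eigenvalues of `B` is
bounded below in terms of `δ` and the trace. -/
theorem trace_sq_sub_trace_mul_self_ge [DecidableEq ι] {B : Matrix ι ι ℝ} {δ : ℝ}
    (hB : (δ • (1 : Matrix ι ι ℝ) - B).PosSemidef) :
    ((Fintype.card ι : ℝ) ^ 2 - Fintype.card ι) * δ ^ 2
      - 2 * ((Fintype.card ι : ℝ) - 1) * δ * (Fintype.card ι * δ - B.trace)
      ≤ B.trace ^ 2 - (B * B).trace := by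
  have h := hB.trace_mul_self_le
  simp only [sub_mul, mul_sub, smul_mul_assoc, mul_smul_comm, one_mul, mul_one,
    trace_sub, trace_smul,
    trace_one, smul_eq_mul] at h
  nlinarith

theorem vecMulVec_mul_vecMulVec_self (p : ι → ℝ) :
    vecMulVec p p * vecMulVec p p = (p ⬝ᵥ p) • vecMulVec p p := by
  rw [vecMulVec_mul_vecMulVec, vecMulVec_smul]

/-- The explicit square root of the inverse of `1 + p pᵀ`. -/
theorem exists_isSymm_sqrt_inv_one_add_vecMulVec [DecidableEq ι] (p : ι → ℝ) :
    ∃ C : Matrix ι ι ℝ, C.IsSymm ∧ C * C = 1 - (1 + p ⬝ᵥ p)⁻¹ • vecMulVec p p ∧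
      C * (1 + vecMulVec p p) * C = 1 := by
  have hq : 0 ≤ p ⬝ᵥ p := Finset.sum_nonneg fun i _ => mul_self_nonneg (p i)
  obtain ⟨w, hw, hwq⟩ : ∃ w : ℝ, 0 < w ∧ p ⬝ᵥ p = w ^ 2 - 1 :=
    ⟨√(1 + p ⬝ᵥ p), by positivity, by rw [Real.sq_sqrt (by positivity)]; ring⟩
  have hV := vecMulVec_mul_vecMulVec_self p
  rw [hwq] at hV ⊢
  refine ⟨1 - (w * (1 + w))⁻¹ • vecMulVec p p, ?_, ?_, ?_⟩
  · simp [IsSymm, transpose_sub, transpose_smul, transpose_vecMulVec]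
  · simp only [mul_sub, sub_mul, smul_mul_assoc, mul_smul_comm, hV, one_mul, mul_one]
    match_scalars
    · simp
    · field_simp
      ring
  · simp only [mul_sub, sub_mul, mul_add, add_mul, smul_mul_assoc, mul_smul_comm, hV, one_mul,
      mul_one, smul_sub, smul_add]
    match_scalars
    · simp
    · field_simp
      ring

end Matrix

/-- The one-dimensional form of the comparison with a circle of radius `s` at its lowest point. -/
theorem deriv_bounds_of_isLocalMax_add_sqrt {φ φ' : ℝ → ℝ} {φ'' s b c : ℝ} (hs : 0 < s)
    (hφ : ∀ t, HasDerivAt φ (φ' t) t) (hφ' : HasDerivAt φ' φ'' 0)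
    (hmax : IsLocalMax (fun t => φ t + √(s ^ 2 - 2 * b * t - c * t ^ 2)) 0) :
    φ' 0 = b / s ∧ φ'' ≤ c / s + b ^ 2 / s ^ 3 := by
  have hpoly : ∀ t, HasDerivAt (fun t : ℝ => s ^ 2 - 2 * b * t - c * t ^ 2)
      (-2 * b - 2 * c * t) t := fun t => by
    have := (((hasDerivAt_id t).const_mul (2 * b)).const_sub (s ^ 2)).sub
      ((hasDerivAt_pow 2 t).const_mul c)
    refine this.congr_deriv ?_
    simp
    ring
  have hpos : ∀ᶠ t : ℝ in nhds 0, 0 < s ^ 2 - 2 * b * t - c * t ^ 2 :=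
    (hpoly 0).continuousAt.eventually_const_lt (by simpa using by positivity)
  have hsqrt : ∀ t, 0 < s ^ 2 - 2 * b * t - c * t ^ 2 →
      HasDerivAt (fun t : ℝ => √(s ^ 2 - 2 * b * t - c * t ^ 2))
        ((-2 * b - 2 * c * t) / (2 * √(s ^ 2 - 2 * b * t - c * t ^ 2))) t :=
    fun t ht => (hpoly t).sqrt ht.ne'
  have hs0 : √(s ^ 2 - 2 * b * 0 - c * 0 ^ 2) = s := by simp [Real.sqrt_sq hs.le]
  have hu := fun t ht => (hφ t).add (hsqrt t ht)
  have hu' : deriv (fun t => φ t + √(s ^ 2 - 2 * b * t - c * t ^ 2)) =ᶠ[nhds 0]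
      fun t => φ' t + (-2 * b - 2 * c * t) / (2 * √(s ^ 2 - 2 * b * t - c * t ^ 2)) := by
    filter_upwards [hpos] with t ht using (hu t ht).deriv
  have h₁ := hmax.deriv_eq_zero
  have h₂ := hmax.deriv_deriv_nonpos (hu 0 hpos.self_of_nhds).continuousAt
  have hlin : HasDerivAt (fun t : ℝ => -2 * b - 2 * c * t) (-(2 * c)) 0 := by
    simpa using ((hasDerivAt_id (0 : ℝ)).const_mul (2 * c)).const_sub (-2 * b)
  have hu'' := hφ'.add (hlin.div ((hsqrt 0 hpos.self_of_nhds).const_mul 2)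
    (by rw [hs0]; positivity))
  rw [hu'.eq_of_nhds, hs0] at h₁
  rw [hu'.deriv_eq] at h₂
  have h₃ := hu''.deriv.symm.trans_le h₂
  rw [hs0] at h₃
  constructor
  · field_simp at h₁ ⊢
    linarith
  · have : c / s + b ^ 2 / s ^ 3 = -((-(2 * c) * (2 * s) - (-2 * b - 2 * c * 0) *
        (2 * ((-2 * b - 2 * c * 0) / (2 * s)))) / (2 * s) ^ 2) := by
      field_simp
      ring
    linarith

section Graph

variable {n : ℕ} {f : EuclideanSpace ℝ (Fin n) → ℝ}

theorem grad_neg (x : EuclideanSpace ℝ (Fin n)) : grad n (-f) x = -grad n f x := by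
  ext i
  simp [grad, fderiv_neg]

theorem gradSq_eq_dotProduct (x : EuclideanSpace ℝ (Fin n)) :
    gradSq n f x = grad n f x ⬝ᵥ grad n f x := by
  simp [gradSq, dotProduct, sq]

theorem gradSq_nonneg (x : EuclideanSpace ℝ (Fin n)) : 0 ≤ gradSq n f x :=
  Finset.sum_nonneg fun _ _ => sq_nonneg _

theorem hess_neg (x : EuclideanSpace ℝ (Fin n)) : hess n (-f) x = -hess n f x := by
  ext i j
  have : (fun y => fderiv ℝ (-f) y (EuclideanSpace.single j 1)) =
      -fun y => fderiv ℝ f y (EuclideanSpace.single j 1) := by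
    ext y
    simp [fderiv_neg]
  simp only [hess, Matrix.of_apply, Matrix.neg_apply, this]
  simp [fderiv_neg]

theorem shapeOp_neg (x : EuclideanSpace ℝ (Fin n)) : shapeOp n (-f) x = -shapeOp n f x := by
  simp [shapeOp, hess_neg, gradSq, grad_neg]

theorem shapeOp_eq (x : EuclideanSpace ℝ (Fin n)) :
    shapeOp n f x = (√(1 + gradSq n f x))⁻¹ •
      ((1 - (1 + gradSq n f x)⁻¹ • Matrix.vecMulVec (grad n f x) (grad n f x)) * hess n f x) := by
  rw [shapeOp]
  congr 3
  ext i j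
  simp [Matrix.vecMulVec_apply, div_eq_inv_mul]

theorem differentiable_fderiv_of_contDiff_two (hf : ContDiff ℝ 2 f) :
    Differentiable ℝ (fderiv ℝ f) :=
  (hf.fderiv_right (m := 1) (by norm_num)).differentiable (by norm_num)

theorem hess_apply (hf : ContDiff ℝ 2 f) (x : EuclideanSpace ℝ (Fin n)) (i j : Fin n) :
    hess n f x i j = fderiv ℝ (fderiv ℝ f) x (EuclideanSpace.single i 1)
      (EuclideanSpace.single j 1) := by
  rw [hess, Matrix.of_apply, fderiv_clm_apply (differentiable_fderiv_of_contDiff_two hf x)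
    (differentiableAt_const _)]
  simp

theorem isSymm_hess (hf : ContDiff ℝ 2 f) (x : EuclideanSpace ℝ (Fin n)) :
    (hess n f x).IsSymm := by
  ext i j
  rw [Matrix.transpose_apply, hess_apply hf, hess_apply hf]
  exact (hf.contDiffAt.isSymmSndFDerivAt (by simp)).eq _ _

theorem continuous_shapeOp (hf : ContDiff ℝ 2 f) : Continuous (shapeOp n f) := by
  have h₁ : Continuous (fderiv ℝ f) := hf.continuous_fderiv (by norm_num)
  have h₂ : Continuous (fderiv ℝ (fderiv ℝ f)) :=
    (hf.fderiv_right (m := 1) (by norm_num)).continuous_fderiv (by norm_num)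
  have hgrad : Continuous (grad n f) := by
    unfold grad
    fun_prop
  have hgradSq : Continuous (gradSq n f) := by
    unfold gradSq
    fun_prop
  have hhess : Continuous (hess n f) := by
    refine continuous_matrix fun i j => ?_
    simp only [hess_apply hf]
    fun_prop
  have hpos : ∀ x, 0 < 1 + gradSq n f x := fun x => by linarith [gradSq_nonneg (f := f) x]
  have heq : shapeOp n f = _ := funext shapeOp_eq
  rw [heq]
  refine Continuous.smul (Continuous.inv₀ (by fun_prop) fun x => (Real.sqrt_pos.2 (hpos x)).ne')
    (Continuous.matrix_mul (continuous_const.sub (Continuous.smul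
      (Continuous.inv₀ (by fun_prop) fun x => (hpos x).ne') ?_)) hhess)
  exact hgrad.matrix_vecMulVec hgrad

/-- The shape operator is conjugate to a symmetric matrix; a bound of the Hessian by that of a
sphere with the same gradient becomes a bound of this symmetric matrix by a multiple of `1`. -/
theorem exists_isSymm_trace_shapeOp (hf : ContDiff ℝ 2 f) (x : EuclideanSpace ℝ (Fin n)) :
    ∃ B : Matrix (Fin n) (Fin n) ℝ, B.IsSymm ∧ B.trace = (shapeOp n f x).trace ∧
      (B * B).trace = (shapeOp n f x * shapeOp n f x).trace ∧
      ∀ δ : ℝ, ((√(1 + gradSq n f x) * δ) •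
        (1 + Matrix.vecMulVec (grad n f x) (grad n f x)) - hess n f x).PosSemidef →
        (δ • (1 : Matrix (Fin n) (Fin n) ℝ) - B).PosSemidef := by
  obtain ⟨C, hC, hCC, hCVC⟩ := Matrix.exists_isSymm_sqrt_inv_one_add_vecMulVec (grad n f x)
  rw [← gradSq_eq_dotProduct] at hCC
  have hS := isSymm_hess hf x
  have hw : 0 < √(1 + gradSq n f x) :=
    Real.sqrt_pos.2 (by linarith [gradSq_nonneg (f := f) x])
  rw [shapeOp_eq, ← hCC]
  generalize √(1 + gradSq n f x) = w at *
  generalize hess n f x = S at *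
  refine ⟨w⁻¹ • (C * S * C), ?_, ?_, ?_, fun δ hδ => ?_⟩
  · rw [Matrix.IsSymm, Matrix.transpose_smul, Matrix.transpose_mul, Matrix.transpose_mul, hC.eq,
      hS.eq, Matrix.mul_assoc]
  · rw [Matrix.trace_smul, Matrix.trace_smul, Matrix.trace_mul_comm, Matrix.mul_assoc]
  · simp only [Matrix.smul_mul, Matrix.mul_smul, Matrix.trace_smul]
    rw [Matrix.trace_mul_comm (C * C * S)]
    congr 2
    rw [show C * S * C * (C * S * C) = C * S * C * C * S * C by simp only [Matrix.mul_assoc],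
      Matrix.trace_mul_comm]
    simp only [Matrix.mul_assoc]
  · have h := (hδ.mul_mul_conjTranspose_same C).smul (inv_nonneg.2 hw.le)
    rw [Matrix.conjTranspose_eq_transpose_of_trivial, hC.eq, Matrix.mul_sub, Matrix.sub_mul,
      Matrix.mul_smul, Matrix.smul_mul, hCVC, smul_sub, smul_smul,
      inv_mul_cancel_left₀ hw.ne'] at h
    exact h

theorem sum_smul_single (v : EuclideanSpace ℝ (Fin n)) :
    ∑ i, v i • EuclideanSpace.single i (1 : ℝ) = v := by
  simpa using (EuclideanSpace.basisFun (Fin n) ℝ).sum_repr v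

theorem dotProduct_hess_mulVec (hf : ContDiff ℝ 2 f) (x v : EuclideanSpace ℝ (Fin n)) :
    v.ofLp ⬝ᵥ (hess n f x).mulVec v.ofLp = fderiv ℝ (fderiv ℝ f) x v v := by
  conv_rhs => rw [← sum_smul_single v]
  simp only [map_sum, map_smul, _root_.sum_apply, smul_apply,
    smul_eq_mul, dotProduct, Matrix.mulVec, hess_apply hf, Finset.mul_sum]
  rw [Finset.sum_comm]
  refine Finset.sum_congr rfl fun i _ => Finset.sum_congr rfl fun j _ => ?_
  ring

/-- The function `f(x) + √(r² - |x|²)` has an interior maximum on the closed ball of radius `r`. -/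
theorem exists_isLocalMax_add_sqrt (hf : ContDiff ℝ 2 f) {r : ℝ} (hr : 0 < r) :
    ∃ x, ‖x‖ < r ∧ IsLocalMax (fun y => f y + √(r ^ 2 - ‖y‖ ^ 2)) x := by
  have hfc := hf.continuous
  obtain ⟨x, hx, hmax⟩ := (isCompact_closedBall (0 : EuclideanSpace ℝ (Fin n)) r).exists_isMaxOn
    ⟨0, by simpa using hr.le⟩ (f := fun y => f y + √(r ^ 2 - ‖y‖ ^ 2)) (by fun_prop)
  have hxr : ‖x‖ ≤ r := by simpa using hx
  suffices h : ‖x‖ < r from ⟨x, h, hmax.isLocalMax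
    (Filter.mem_of_superset (isOpen_ball.mem_nhds (by simpa using h)) ball_subset_closedBall)⟩
  by_contra! hle
  have hxr : ‖x‖ = r := le_antisymm hxr hle
  have hd : HasDerivAt (fun t : ℝ => f (t • x)) (fderiv ℝ f x x) 1 := by
    have hF : HasFDerivAt f (fderiv ℝ f x) ((1 : ℝ) • x) := by
      rw [one_smul]
      exact (hf.differentiable (by norm_num) x).hasFDerivAt
    simpa [Function.comp_def] using hF.comp_hasDerivAt (1 : ℝ)
      ((hasDerivAt_id (1 : ℝ)).smul_const x)
  obtain ⟨K, hK, hb⟩ := hd.isBigO_sub.exists_pos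
  have hevent : ∀ᶠ t : ℝ in nhdsWithin 1 (Set.Iio 1),
      K ^ 2 * (1 - t) < r ^ 2 ∧ t ∈ Set.Ioo (0 : ℝ) 1 ∧
        ‖f (t • x) - f ((1 : ℝ) • x)‖ ≤ K * ‖t - 1‖ := by
    refine .and ?_ (.and (Ioo_mem_nhdsLT one_pos) (hb.bound.filter_mono nhdsWithin_le_nhds))
    have : ContinuousAt (fun t : ℝ => K ^ 2 * (1 - t)) 1 := by fun_prop
    exact (this.eventually_lt_const (by simpa using by positivity)).filter_mono nhdsWithin_le_nhds
  obtain ⟨t, htK, ⟨ht0, ht1⟩, htb⟩ := hevent.exists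
  have hnorm : ‖t • x‖ = t * r := by rw [norm_smul, Real.norm_of_nonneg ht0.le, hxr]
  have hle := isMaxOn_iff.1 hmax (t • x) (by
    rw [mem_closedBall_zero_iff, hnorm]
    nlinarith)
  simp only [hnorm, hxr, sub_self, Real.sqrt_zero, add_zero] at hle
  rw [one_smul, Real.norm_eq_abs, Real.norm_eq_abs, abs_of_neg (by linarith : t - 1 < 0)] at htb
  have hlow : K * (1 - t) < √(r ^ 2 - (t * r) ^ 2) := by
    apply Real.lt_sqrt_of_sq_lt
    nlinarith [mul_pos (sub_pos.2 ht1) (sub_pos.2 htK), mul_pos ht0 (sub_pos.2 ht1),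
      mul_pos (mul_pos ht0 (sub_pos.2 ht1)) (pow_pos hr 2)]
  linarith [neg_abs_le (f (t • x) - f x)]

/-- Comparison of the graph of `f` with a sphere of curvature `δ` touching it from above. -/
theorem exists_posSemidef_sub_hess (hf : ContDiff ℝ 2 f) {δ : ℝ} (hδ : 0 < δ) :
    ∃ x, ((√(1 + gradSq n f x) * δ) •
      (1 + Matrix.vecMulVec (grad n f x) (grad n f x)) - hess n f x).PosSemidef := by
  obtain ⟨x, hx, hmax⟩ := exists_isLocalMax_add_sqrt hf (inv_pos.2 hδ)
  obtain ⟨s, hs, hsx⟩ : ∃ s : ℝ, 0 < s ∧ s ^ 2 = δ⁻¹ ^ 2 - ‖x‖ ^ 2 := by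
    have : 0 < δ⁻¹ ^ 2 - ‖x‖ ^ 2 := by nlinarith [norm_nonneg x]
    exact ⟨√(δ⁻¹ ^ 2 - ‖x‖ ^ 2), Real.sqrt_pos.2 this, Real.sq_sqrt this.le⟩
  have key : ∀ v : EuclideanSpace ℝ (Fin n), fderiv ℝ f x v = inner ℝ x v / s ∧
      fderiv ℝ (fderiv ℝ f) x v v ≤ ‖v‖ ^ 2 / s + inner ℝ x v ^ 2 / s ^ 3 := fun v => by
    have hline : ∀ t : ℝ, HasDerivAt (fun t : ℝ => x + t • v) v t := fun t => by
      simpa using ((hasDerivAt_id t).smul_const v).const_add x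
    have h := deriv_bounds_of_isLocalMax_add_sqrt (φ := fun t => f (x + t • v))
      (φ' := fun t => fderiv ℝ f (x + t • v) v) (φ'' := fderiv ℝ (fderiv ℝ f) x v v)
      (b := inner ℝ x v) (c := ‖v‖ ^ 2) hs
      (fun t => (hf.differentiable (by norm_num) _).hasFDerivAt.comp_hasDerivAt t (hline t)) ?_ ?_
    · simpa using h
    · have hF : HasFDerivAt (fderiv ℝ f) (fderiv ℝ (fderiv ℝ f) x) (x + (0 : ℝ) • v) := by
        rw [zero_smul, add_zero]
        exact (differentiable_fderiv_of_contDiff_two hf x).hasFDerivAt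
      exact (ContinuousLinearMap.apply ℝ ℝ v).hasFDerivAt.comp_hasDerivAt (0 : ℝ)
        (hF.comp_hasDerivAt (0 : ℝ) (hline 0))
    · have hmax' : IsLocalMax (fun y => f y + √(δ⁻¹ ^ 2 - ‖y‖ ^ 2)) (x + (0 : ℝ) • v) := by
        simpa using hmax
      have := hmax'.comp_continuous (g := fun t : ℝ => x + t • v) (b := 0) (by fun_prop)
      refine this.congr (.of_forall fun t => ?_)
      simp only [Function.comp_apply, hsx, norm_add_sq_real, inner_smul_right, norm_smul, mul_pow,
        Real.norm_eq_abs, sq_abs]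
      congr 2
      ring
  have hgrad : grad n f x = s⁻¹ • x.ofLp := by
    ext i
    rw [grad, (key _).1]
    simp [EuclideanSpace.inner_single_right, div_eq_inv_mul]
  have hw : √(1 + gradSq n f x) * δ = s⁻¹ := by
    have : 1 + gradSq n f x = (s⁻¹ * δ⁻¹) ^ 2 := by
      have hx2 : ∑ i, x.ofLp i ^ 2 = ‖x‖ ^ 2 := by simp [EuclideanSpace.norm_sq_eq]
      rw [gradSq, hgrad]
      simp only [Pi.smul_apply, smul_eq_mul, mul_pow, ← Finset.mul_sum, hx2]
      rw [show ‖x‖ ^ 2 = δ⁻¹ ^ 2 - s ^ 2 by linarith]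
      field_simp
      ring
    rw [this, Real.sqrt_sq (by positivity), inv_mul_cancel_right₀ hδ.ne']
  refine ⟨x, .of_dotProduct_mulVec_nonneg ?_ fun v => ?_⟩
  · have hS := isSymm_hess hf x
    rw [Matrix.IsHermitian, Matrix.conjTranspose_eq_transpose_of_trivial]
    simp [Matrix.transpose_sub, Matrix.transpose_add, hS.eq, Matrix.transpose_vecMulVec]
  · have h := (key (WithLp.toLp 2 v)).2
    rw [← dotProduct_hess_mulVec hf] at h
    have hv : ‖WithLp.toLp 2 v‖ ^ 2 = v ⬝ᵥ v := by
      simp [EuclideanSpace.norm_sq_eq, dotProduct, ← sq]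
    have hxv : inner ℝ x (WithLp.toLp 2 v) = x.ofLp ⬝ᵥ v := by
      simp [EuclideanSpace.inner_eq_star_dotProduct, dotProduct_comm]
    rw [hv, hxv] at h
    rw [hw, hgrad, star_trivial, Matrix.sub_mulVec, Matrix.smul_mulVec, Matrix.add_mulVec,
      Matrix.one_mulVec, Matrix.vecMulVec_mulVec, dotProduct_sub, dotProduct_smul, dotProduct_add]
    simp only [op_smul_eq_smul, dotProduct_smul, smul_dotProduct, smul_eq_mul,
      dotProduct_comm v x.ofLp]
    rw [sub_nonneg]
    refine h.trans_eq ?_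
    field_simp

end Graph

/-- **Corollary 1 (improving Elbert and Hasanis–Vlachos).** If an entire graph in
`ℝ^{n+1}` has bounded mean curvature, then `inf |R| = 0`: for every `ε > 0` there
is a point where `|R| < ε`. -/
theorem inf_scalarCurv_entire_graph_eq_zero_of_bounded_meanCurv
    (n : ℕ) (hn : 2 ≤ n)
    (f : EuclideanSpace ℝ (Fin n) → ℝ) (hf : ContDiff ℝ 2 f)
    (hH : ∃ C : ℝ, ∀ x : EuclideanSpace ℝ (Fin n), |meanCurv n f x| ≤ C) :
    ∀ ε > 0, ∃ x : EuclideanSpace ℝ (Fin n), |scalarCurv n f x| < ε := by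
  intro ε hε
  obtain ⟨M, hM⟩ := hH
  have hM0 : 0 ≤ M := (abs_nonneg _).trans (hM 0)
  have hn' : (2 : ℝ) ≤ n := by exact_mod_cast hn
  have hW := continuous_shapeOp hf
  have htr : ∀ x, -(n * M) ≤ (shapeOp n f x).trace := fun x => by
    have := (abs_le.1 (hM x)).1
    rw [meanCurv, le_div_iff₀ (by positivity)] at this
    linarith
  have hnn : (0 : ℝ) < n * (n - 1) := by nlinarith
  set η : ℝ := ε / 2 * (n * (n - 1)) with hη
  have hη0 : 0 < η := by positivity
  obtain ⟨δ, hδ, hδ1, hδη⟩ : ∃ δ : ℝ, 0 < δ ∧ δ ≤ 1 ∧ δ * (2 * n * n * (1 + M)) ≤ η := by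
    have hD : (0 : ℝ) < 2 * n * n * (1 + M) := by positivity
    refine ⟨min 1 (η / (2 * n * n * (1 + M))), by positivity, min_le_left _ _, ?_⟩
    exact (le_div_iff₀ hD).1 (min_le_right _ _)
  have hupper : ∀ g : EuclideanSpace ℝ (Fin n) → ℝ, ContDiff ℝ 2 g → ∃ x,
      (shapeOp n g x).trace ≤ n * δ ∧
      ((n : ℝ) ^ 2 - n) * δ ^ 2 - 2 * ((n : ℝ) - 1) * δ * (n * δ - (shapeOp n g x).trace) ≤
        (shapeOp n g x).trace ^ 2 - (shapeOp n g x * shapeOp n g x).trace := fun g hg => by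
    obtain ⟨x, hx⟩ := exists_posSemidef_sub_hess hg hδ
    obtain ⟨B, -, hB₁, hB₂, hB₃⟩ := exists_isSymm_trace_shapeOp hg x
    have h₁ := (hB₃ δ hx).trace_nonneg
    have h₂ := Matrix.trace_sq_sub_trace_mul_self_ge (hB₃ δ hx)
    simp only [Matrix.trace_sub, Matrix.trace_smul, Matrix.trace_one, Fintype.card_fin,
      smul_eq_mul, hB₁, hB₂] at h₁ h₂
    exact ⟨x, by linarith, h₂⟩
  obtain ⟨x, hx, hxQ⟩ := hupper f hf
  obtain ⟨y, hy, -⟩ := hupper (-f) hf.neg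
  rw [shapeOp_neg, Matrix.trace_neg] at hy
  obtain ⟨z, hz⟩ := exists_abs_le_of_exists_le_of_exists_ge (T := fun x => (shapeOp n f x).trace)
    hW.matrix_trace (by positivity : 0 ≤ n * δ) ⟨x, hx⟩ ⟨y, by linarith⟩
  have hle : scalarCurv n f z ≤ ε / 2 := by
    obtain ⟨B, hB, -, hB₂, -⟩ := exists_isSymm_trace_shapeOp hf z
    have h₁ := hB.trace_mul_self_nonneg
    rw [hB₂] at h₁
    have h₂ : (shapeOp n f z).trace ^ 2 ≤ (n * δ) ^ 2 := sq_le_sq' (abs_le.1 hz).1 (abs_le.1 hz).2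
    have h₃ : (n * δ) ^ 2 ≤ δ * (2 * n * n * (1 + M)) := by
      calc (n * δ) ^ 2 = n * n * δ * δ := by ring
        _ ≤ n * n * δ * (2 * (1 + M)) := by gcongr; linarith
        _ = δ * (2 * n * n * (1 + M)) := by ring
    rw [scalarCurv, div_le_iff₀ hnn]
    linarith
  have hge : -(ε / 2) ≤ scalarCurv n f x := by
    have h₁ : 2 * ((n : ℝ) - 1) * δ * (n * δ - (shapeOp n f x).trace) ≤
        δ * (2 * n * n * (1 + M)) := by
      calc 2 * ((n : ℝ) - 1) * δ * (n * δ - (shapeOp n f x).trace)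
          ≤ 2 * n * δ * (n * 1 + n * M) := by
            have := htr x
            have hT : 0 ≤ n * δ - (shapeOp n f x).trace := by linarith
            have hδn : n * δ ≤ n * 1 := by gcongr
            gcongr <;> linarith
        _ = δ * (2 * n * n * (1 + M)) := by ring
    have h₂ : 0 ≤ ((n : ℝ) ^ 2 - n) * δ ^ 2 := by
      have : 0 ≤ (n : ℝ) ^ 2 - n := by nlinarith
      positivity
    rw [scalarCurv, le_div_iff₀ hnn]
    linarith
  obtain ⟨p, hp⟩ := exists_abs_le_of_exists_le_of_exists_ge (T := scalarCurv n f) (a := ε / 2)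
    (((hW.matrix_trace.pow 2).sub (hW.matrix_mul hW).matrix_trace).div_const _) (by positivity)
    ⟨z, hle⟩ ⟨x, hge⟩
  exact ⟨p, by linarith⟩
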